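/- Let A be a finite-dimensional K-algebra and G a finite group acting on A with char K ∤ |G|, and M a finitely generated A ∗ G-module. Then M ⊗_K KG is a quasi-Koszul A ∗ G-module if and only if M is a quasi-Koszul A-module. -/

import Mathlib

open CategoryTheory

universe u

noncomputable instance (A : Type u) [Ring A] : HasDerivedCategory (ModuleCat.{u} A) :=
  HasDerivedCategory.standard _

instance (A : Type u) [Ring A] : HasExt.{u+1} (ModuleCat.{u} A) :=
  CategoryTheory.hasExt_of_hasDerivedCategory _

/-- The Jacobson radical of a ring, as a left ideal. -/
def jacRad (A : Type u) [Ring A] : Ideal A := Ideal.jacobson ⊥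

/-- The semisimple quotient `A/J(A)` as a left `A`-module. -/
abbrev ssQuot (A : Type u) [Ring A] : ModuleCat.{u} A :=
  ModuleCat.of A (A ⧸ jacRad A)

/-- A ring is semiperfect if `A/J(A)` is semisimple and idempotents lift
modulo the Jacobson radical. -/
def IsSemiperfectRing (A : Type u) [Ring A] : Prop :=
  IsSemisimpleModule A (A ⧸ jacRad A) ∧
    ∀ a : A, a * a - a ∈ jacRad A →
      ∃ e : A, IsIdempotentElem e ∧ e - a ∈ jacRad A

/-- Additive span of Yoneda products. -/
noncomputable def extSpan {C : Type (u+1)} [Category C] [Abelian C] [HasExt.{u+1} C]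
    (X Y Z : C) (r l : ℕ) : AddSubgroup (Abelian.Ext X Z (r + l)) :=
  AddSubgroup.closure { γ | ∃ (α : Abelian.Ext X Y r) (β : Abelian.Ext Y Z l), γ = α.comp β rfl }

/-- A ring `A` is quasi-Koszul if its Yoneda algebra `Ext^*_A(A/J, A/J)` is generated in
degrees 0 and 1: `Ext^i · Ext^1 = Ext^{i+1}` for all `i ≥ 0`. -/
def IsQuasiKoszul (A : Type u) [Ring A] : Prop :=
  ∀ i : ℕ, extSpan (ssQuot A) (ssQuot A) (ssQuot A) i 1 = ⊤

/-- An `A`-module `M` is quasi-Koszul if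
`Ext^i_A(M, A/J) · Ext^1_A(A/J, A/J) = Ext^{i+1}_A(M, A/J)` for all `i ≥ 0`. -/
def IsQuasiKoszulModule (A : Type u) [Ring A] (M : ModuleCat.{u} A) : Prop :=
  ∀ i : ℕ, extSpan M (ssQuot A) (ssQuot A) i 1 = ⊤


/-- `B` is a skew group algebra `A ∗ G` for the action `φ` of `G` on the `K`-algebra `A`:
`B` contains `A` and invertible elements indexed by `G` satisfying the skew commutation
rule `g · a = (g a) · g`, and `B` is free as an `A`-module with basis `G`. -/
structure IsSkewGroupAlgebra (K : Type u) [Field K] (A : Type u) [Ring A] [Algebra K A]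
    (G : Type u) [Group G] [Fintype G] (φ : G →* (A ≃ₐ[K] A))
    (B : Type u) [Ring B] [Algebra K B] where
  ιA : A →ₐ[K] B
  ιG : G →* B
  comm : ∀ (g : G) (a : A), ιG g * ιA a = ιA (φ g a) * ιG g
  free : ∀ b : B, ∃! c : G → A, b = ∑ g : G, ιA (c g) * ιG g

section ExtSpan

variable {C : Type (u + 1)} [Category C] [Abelian C] [HasExt.{u + 1} C]
variable {D : Type (u + 1)} [Category D] [Abelian D] [HasExt.{u + 1} D]

open Abelian

/-- `X` is a direct summand of a finite direct sum of copies of `Y`. -/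
def IsSummandOfPower {C : Type*} [Category C] [Preadditive C] (X Y : C) : Prop :=
  ∃ (n : ℕ) (p : Fin n → (X ⟶ Y)) (i : Fin n → (Y ⟶ X)), ∑ k, p k ≫ i k = 𝟙 X

lemma mk₀_comp_mem_extSpan {X' X Y Z : C} {r l : ℕ} (f : X' ⟶ X) {γ : Ext X Z (r + l)}
    (hγ : γ ∈ extSpan X Y Z r l) :
    (Ext.mk₀ f).comp γ (zero_add _) ∈ extSpan X' Y Z r l := by
  induction hγ using AddSubgroup.closure_induction with
  | mem x hx =>
    obtain ⟨α, β, rfl⟩ := hx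
    refine AddSubgroup.subset_closure ⟨(Ext.mk₀ f).comp α (zero_add _), β, ?_⟩
    rw [Ext.comp_assoc]
    omega
  | zero => simp
  | add x y _ _ hx hy => simpa using add_mem hx hy
  | neg x _ hx => simpa using neg_mem hx

lemma comp_mk₀_mem_extSpan {X Y Z Z' : C} {r l : ℕ} (f : Z ⟶ Z') {γ : Ext X Z (r + l)}
    (hγ : γ ∈ extSpan X Y Z r l) :
    γ.comp (Ext.mk₀ f) (add_zero _) ∈ extSpan X Y Z' r l := by
  induction hγ using AddSubgroup.closure_induction with
  | mem x hx =>
    obtain ⟨α, β, rfl⟩ := hx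
    refine AddSubgroup.subset_closure ⟨α, β.comp (Ext.mk₀ f) (add_zero _), ?_⟩
    rw [Ext.comp_assoc]
    omega
  | zero => simp
  | add x y _ _ hx hy => simpa using add_mem hx hy
  | neg x _ hx => simpa using neg_mem hx

lemma extSpan_le_of_isSummandOfPower {Y Y' : C} (h : IsSummandOfPower Y Y') (X Z : C) (r l : ℕ) :
    extSpan X Y Z r l ≤ extSpan X Y' Z r l := by
  obtain ⟨n, p, i, hpi⟩ := h
  rw [extSpan, AddSubgroup.closure_le]
  rintro _ ⟨α, β, rfl⟩
  have hβ : β = ∑ k, (Ext.mk₀ (p k)).comp ((Ext.mk₀ (i k)).comp β (zero_add l)) (zero_add l) := by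
    conv_lhs => rw [← Ext.mk₀_id_comp β, ← hpi, Ext.mk₀_sum, Ext.sum_comp]
    simp
  rw [hβ, Ext.comp_sum]
  refine sum_mem fun k _ ↦ AddSubgroup.subset_closure
    ⟨α.comp (Ext.mk₀ (p k)) (add_zero r), (Ext.mk₀ (i k)).comp β (zero_add l), ?_⟩
  rw [Ext.comp_assoc]
  omega

lemma extSpan_eq_top_of_left {X X' Y Z : C} {r l : ℕ} (h : IsSummandOfPower X X')
    (htop : extSpan X' Y Z r l = ⊤) : extSpan X Y Z r l = ⊤ := by
  obtain ⟨n, p, i, hpi⟩ := h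
  refine eq_top_iff.2 fun γ _ ↦ ?_
  have hγ : γ = ∑ k, (Ext.mk₀ (p k)).comp ((Ext.mk₀ (i k)).comp γ (zero_add _)) (zero_add _) := by
    conv_lhs => rw [← Ext.mk₀_id_comp γ, ← hpi, Ext.mk₀_sum, Ext.sum_comp]
    simp
  rw [hγ]
  exact sum_mem fun k _ ↦ mk₀_comp_mem_extSpan _ (htop ▸ AddSubgroup.mem_top _)

lemma extSpan_eq_top_of_right {X Y Z Z' : C} {r l : ℕ} (h : IsSummandOfPower Z Z')
    (htop : extSpan X Y Z' r l = ⊤) : extSpan X Y Z r l = ⊤ := by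
  obtain ⟨n, p, i, hpi⟩ := h
  refine eq_top_iff.2 fun γ _ ↦ ?_
  have hγ : γ = ∑ k, (γ.comp (Ext.mk₀ (p k)) (add_zero _)).comp (Ext.mk₀ (i k)) (add_zero _) := by
    conv_lhs => rw [← Ext.comp_mk₀_id γ, ← hpi, Ext.mk₀_sum, Ext.comp_sum]
    simp
  rw [hγ]
  exact sum_mem fun k _ ↦ comp_mk₀_mem_extSpan _ (htop ▸ AddSubgroup.mem_top _)

lemma mapExactFunctor_mem_extSpan (F : C ⥤ D) [F.Additive] [Limits.PreservesFiniteLimits F]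
    [Limits.PreservesFiniteColimits F] {X Y Z : C} {r l : ℕ} {γ : Ext X Z (r + l)}
    (hγ : γ ∈ extSpan X Y Z r l) :
    γ.mapExactFunctor F ∈ extSpan (F.obj X) (F.obj Y) (F.obj Z) r l := by
  induction hγ using AddSubgroup.closure_induction with
  | mem x hx =>
    obtain ⟨α, β, rfl⟩ := hx
    exact AddSubgroup.subset_closure
      ⟨α.mapExactFunctor F, β.mapExactFunctor F, Ext.mapExactFunctor_comp ..⟩
  | zero => simp
  | add x y _ _ hx hy => simpa using add_mem hx hy
  | neg x _ hx =>
    rw [← Functor.mapExtAddHom_apply, map_neg]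
    exact neg_mem hx

end ExtSpan

section SeparableTransfer

variable {C : Type (u + 1)} [Category C] [Abelian C] [HasExt.{u + 1} C]
variable {D : Type (u + 1)} [Category D] [Abelian D] [HasExt.{u + 1} D]
variable (F : C ⥤ D) [F.Additive] [Limits.PreservesFiniteLimits F]
  [Limits.PreservesFiniteColimits F]
variable (R : D ⥤ C) [R.Additive] [Limits.PreservesFiniteLimits R]
  [Limits.PreservesFiniteColimits R]

open Abelian

lemma comp_mk₀_app_eq [EnoughProjectives C] (η : 𝟭 C ⟶ F ⋙ R) {n : ℕ} {X Y : C}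
    (γ : Ext X Y n) :
    γ.comp (Ext.mk₀ (η.app Y)) (add_zero n) =
      (Ext.mk₀ (η.app X)).comp ((γ.mapExactFunctor F).mapExactFunctor R) (zero_add n) := by
  induction n generalizing X with
  | zero =>
    obtain ⟨f, rfl⟩ := (Ext.mk₀_bijective X Y).2 γ
    have := η.naturality f
    dsimp at this
    simp [Ext.mapExactFunctor_mk₀, this]
  | succ n ih =>
    let S : ShortComplex C := .mk (Limits.kernel.ι (Projective.π X)) (Projective.π X) (by simp)
    have hS : S.ShortExact :=
      { exact := ShortComplex.exact_of_f_is_kernel _ (Limits.kernelIsKernel _) }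
    obtain ⟨δ, rfl⟩ : ∃ δ : Ext S.X₁ Y n, hS.extClass.comp δ (add_comm 1 n) = γ :=
      Ext.contravariant_sequence_exact₃ hS Y γ (Ext.eq_zero_of_projective _) _
    let f : S ⟶ (S.map F).map R :=
      { τ₁ := η.app _
        τ₂ := η.app _
        τ₃ := η.app _
        comm₁₂ := (η.naturality S.f).symm
        comm₂₃ := (η.naturality S.g).symm }
    have hf : hS.extClass.comp (Ext.mk₀ (η.app S.X₁)) (add_zero 1) =
        (Ext.mk₀ (η.app X)).comp ((hS.extClass.mapExactFunctor F).mapExactFunctor R)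
          (zero_add 1) := by
      have e : (hS.extClass.mapExactFunctor F).mapExactFunctor R =
          ((hS.map_of_exact F).map_of_exact R).extClass :=
        (congrArg (Ext.mapExactFunctor R) (Ext.mapExactFunctor_extClass F hS)).trans
          (Ext.mapExactFunctor_extClass R _)
      exact (ShortComplex.ShortExact.extClass_naturality hS
        ((hS.map_of_exact F).map_of_exact R) f).trans
          (congrArg (fun x ↦ (Ext.mk₀ (η.app X)).comp x (zero_add 1)) e.symm)
    rw [Ext.comp_assoc (h := by omega) (h₂₃ := add_zero n), ih, ← Ext.comp_assoc
      (h₁₂ := add_zero 1) (h := by omega), hf, Ext.mapExactFunctor_comp,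
      Ext.mapExactFunctor_comp, Ext.comp_assoc]
    omega

/-- Decomposability of all extension classes descends along a pair of exact functors `F`, `R` such
that the identity functor is a direct summand of `F ⋙ R`. -/
theorem extSpan_eq_top_of_retract [EnoughProjectives C] (η : 𝟭 C ⟶ F ⋙ R) (ρ : F ⋙ R ⟶ 𝟭 C)
    (hηρ : η ≫ ρ = 𝟙 _) {X S : C} {Y T : D} (hX : IsSummandOfPower (F.obj X) Y)
    (hS : IsSummandOfPower (F.obj S) T) (hT : IsSummandOfPower (R.obj T) S) (r l : ℕ)
    (htop : extSpan Y T T r l = ⊤) : extSpan X S S r l = ⊤ := by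
  refine eq_top_iff.2 fun γ _ ↦ ?_
  have hγ : γ = ((Ext.mk₀ (η.app X)).comp ((γ.mapExactFunctor F).mapExactFunctor R)
      (zero_add _)).comp (Ext.mk₀ (ρ.app S)) (add_zero _) := by
    rw [← comp_mk₀_app_eq, Ext.comp_assoc (h₂₃ := add_zero 0) (h := by omega),
      Ext.mk₀_comp_mk₀, ← NatTrans.comp_app, hηρ]
    simp
  have hF : γ.mapExactFunctor F ∈ extSpan (F.obj X) T (F.obj S) r l := by
    rw [extSpan_eq_top_of_left hX (extSpan_eq_top_of_right hS htop)]
    trivial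
  rw [hγ]
  exact comp_mk₀_mem_extSpan _ (mk₀_comp_mem_extSpan _
    (extSpan_le_of_isSummandOfPower hT _ _ _ _ (mapExactFunctor_mem_extSpan R hF)))

end SeparableTransfer

lemma isSummandOfPower_of_fintype {C : Type*} [Category C] [Preadditive C] {X Y : C}
    {ι : Type*} [Fintype ι] (p : ι → (X ⟶ Y)) (i : ι → (Y ⟶ X))
    (h : ∑ k, p k ≫ i k = 𝟙 X) : IsSummandOfPower X Y :=
  ⟨Fintype.card ι, fun k ↦ p ((Fintype.equivFin ι).symm k),
    fun k ↦ i ((Fintype.equivFin ι).symm k), by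
    rw [← h, ← Equiv.sum_comp (Fintype.equivFin ι).symm]⟩

section Artinian

variable {A : Type u} [Ring A]

lemma mem_jacRad_iff {a : A} : a ∈ jacRad A ↔ a ∈ Ring.jacobson A := by
  rw [jacRad, Ideal.jacobson_bot]

lemma map_mem_jacRad (e : A ≃+* A) {a : A} (ha : a ∈ jacRad A) : e a ∈ jacRad A := by
  rw [mem_jacRad_iff] at ha ⊢
  have : RingHomSurjective (e : A →+* A) := ⟨e.surjective⟩
  exact Ring.le_comap_jacobson (e : A →+* A) ha

lemma isSemisimpleModule_of_jacRad_smul_eq_zero [IsArtinianRing A] {N : Type*} [AddCommGroup N]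
    [Module A N] (h : ∀ a ∈ jacRad A, ∀ x : N, a • x = 0) : IsSemisimpleModule A N := by
  have ht : Module.IsTorsionBySet A N (Ring.jacobson A) :=
    fun x a ↦ h a (mem_jacRad_iff.2 a.2) x
  let _ := ht.module
  exact (ht.semilinearMap.isSemisimpleModule_iff_of_bijective Function.bijective_id).2
    inferInstance

lemma jacRad_smul_quotient_eq_zero {a : A} (ha : a ∈ jacRad A) (x : A ⧸ jacRad A) :
    a • x = 0 := by
  obtain ⟨b, rfl⟩ := Submodule.Quotient.mk_surjective _ x
  rw [← Submodule.Quotient.mk_smul, Submodule.Quotient.mk_eq_zero, mem_jacRad_iff, smul_eq_mul]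
  exact Ideal.mul_mem_right _ _ (mem_jacRad_iff.1 ha)

lemma isSummandOfPower_ssQuot [IsArtinianRing A] (N : ModuleCat.{u} A) [Module.Finite A N]
    (h : ∀ a ∈ jacRad A, ∀ x : N, a • x = 0) : IsSummandOfPower N (ssQuot A) := by
  obtain ⟨n, s, hs⟩ := Module.Finite.exists_fin (R := A) (M := N)
  let j (k : Fin n) : (A ⧸ jacRad A) →ₗ[A] N :=
    (jacRad A).liftQ (LinearMap.toSpanSingleton A N (s k)) fun a ha ↦ h a ha (s k)
  let f : (Fin n → A ⧸ jacRad A) →ₗ[A] N := LinearMap.lsum A _ ℕ j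
  have hf : Function.Surjective f := by
    rw [← LinearMap.range_eq_top, eq_top_iff, ← hs, Submodule.span_le]
    rintro _ ⟨k, rfl⟩
    exact ⟨Pi.single k (Submodule.Quotient.mk 1), by
      rw [LinearMap.lsum_piSingle]
      exact one_smul A (s k)⟩
  have : IsSemisimpleModule A (Fin n → A ⧸ jacRad A) :=
    isSemisimpleModule_of_jacRad_smul_eq_zero fun a ha x ↦
      funext fun k ↦ jacRad_smul_quotient_eq_zero ha (x k)
  obtain ⟨g, hg⟩ := IsSemisimpleModule.lifting_property f hf LinearMap.id
  refine ⟨n, fun k ↦ ModuleCat.ofHom (LinearMap.proj k ∘ₗ g), fun k ↦ ModuleCat.ofHom (j k), ?_⟩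
  ext x
  have hx := LinearMap.congr_fun hg x
  simp only [f, LinearMap.comp_apply, LinearMap.lsum_apply, LinearMap.sum_apply,
    LinearMap.proj_apply, LinearMap.id_apply] at hx
  simpa [ModuleCat.hom_sum] using hx

end Artinian

namespace IsSkewGroupAlgebra

variable {K : Type u} [Field K] {A : Type u} [Ring A] [Algebra K A]
  {G : Type u} [Group G] [Fintype G] {φ : G →* (A ≃ₐ[K] A)}
  {B : Type u} [Ring B] [Algebra K B] (H : IsSkewGroupAlgebra K A G φ B)

/-- The coefficients of an element of `A ∗ G` with respect to the left `A`-basis `G`. -/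
noncomputable def coeff (b : B) : G → A := (H.free b).choose

lemma sum_coeff (b : B) : ∑ g, H.ιA (H.coeff b g) * H.ιG g = b :=
  (H.free b).choose_spec.1.symm

lemma coeff_eq {b : B} {c : G → A} (h : ∑ g, H.ιA (c g) * H.ιG g = b) : H.coeff b = c :=
  ((H.free b).choose_spec.2 c h.symm).symm

lemma coeff_add (b b' : B) : H.coeff (b + b') = H.coeff b + H.coeff b' :=
  H.coeff_eq (by simp [add_mul, Finset.sum_add_distrib, sum_coeff])

lemma coeff_ιA_mul (a : A) (b : B) (g : G) : H.coeff (H.ιA a * b) g = a * H.coeff b g := by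
  rw [H.coeff_eq (c := fun g ↦ a * H.coeff b g)]
  simp [mul_assoc, ← Finset.mul_sum, sum_coeff]

open Classical in
lemma coeff_ιG (g : G) : H.coeff (H.ιG g) = Pi.single g 1 :=
  H.coeff_eq (by simp [Pi.single_apply, apply_ite H.ιA, ite_mul])

include H in
lemma moduleFinite [FiniteDimensional K A] : Module.Finite K B := by
  let f : (G → A) →ₗ[K] B :=
    ∑ g, (LinearMap.mulRight K (H.ιG g)) ∘ₗ H.ιA.toLinearMap ∘ₗ LinearMap.proj g
  refine Module.Finite.of_surjective f fun b ↦ ⟨H.coeff b, ?_⟩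
  simpa [f] using H.sum_coeff b

/-- Additive maps commuting with the elements `a g` are linear over the skew group algebra. -/
lemma map_smul_of_forall {N N' : Type*} [AddCommGroup N] [Module B N] [AddCommGroup N']
    [Module B N'] (f : N →+ N')
    (h : ∀ a g x, f ((H.ιA a * H.ιG g) • x) = (H.ιA a * H.ιG g) • f x) (b : B) (x : N) :
    f (b • x) = b • f x := by
  rw [← H.sum_coeff b, Finset.sum_smul, Finset.sum_smul, map_sum]
  exact Finset.sum_congr rfl fun g _ ↦ h _ _ _

/-- The image of the radical of `A` lies in the radical of the skew group algebra. -/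
lemma ιA_mem_jacRad [FiniteDimensional K A] {a : A} (ha : a ∈ jacRad A) :
    H.ιA a ∈ jacRad B := by
  rw [mem_jacRad_iff, Ring.jacobson_eq_sInf_isMaximal, Submodule.mem_sInf]
  intro m hm
  let _ : Module A (B ⧸ m) := Module.compHom _ H.ιA.toRingHom
  have smul_def (a : A) (x : B ⧸ m) : a • x = H.ιA a • x := rfl
  let N : Submodule A (B ⧸ m) := Ring.jacobson A • ⊤
  have hG (g : G) {x : B ⧸ m} (hx : x ∈ N) : H.ιG g • x ∈ N := by
    refine Submodule.smul_induction_on hx (fun a ha y _ ↦ ?_) fun x y hx hy ↦ ?_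
    · rw [smul_def, ← mul_smul, H.comm, mul_smul, ← smul_def]
      exact Submodule.smul_mem_smul (mem_jacRad_iff.1 (map_mem_jacRad (φ g : A ≃+* A)
        (mem_jacRad_iff.2 ha))) trivial
    · rw [smul_add]
      exact add_mem hx hy
  let P : Submodule B (B ⧸ m) :=
    { N with
      smul_mem' b x hx := by
        rw [← H.sum_coeff b, Finset.sum_smul]
        refine N.sum_mem fun g _ ↦ ?_
        rw [mul_smul, ← smul_def]
        exact N.smul_mem _ (hG g hx) }
  have : IsSimpleModule B (B ⧸ m) := isSimpleModule_iff_isCoatom.2 (Ideal.isMaximal_def.1 hm)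
  have hfin : Module.Finite A (B ⧸ m) := by
    have := H.moduleFinite
    let _ : Module K (B ⧸ m) := inferInstance
    have : IsScalarTower K A (B ⧸ m) := ⟨fun k a x ↦ by
      rw [smul_def, map_smul, smul_def, smul_assoc]⟩
    exact Module.Finite.of_restrictScalars_finite K A _
  have : Nontrivial (B ⧸ m) := IsSimpleModule.nontrivial B _
  have hlt : N < ⊤ := Submodule.FG.jacobson_smul_lt top_ne_bot hfin.fg_top
  have hP : P = ⊥ := (eq_bot_or_eq_top P).resolve_right fun h ↦ hlt.ne <| by
    ext x
    exact ⟨fun _ ↦ trivial, fun _ ↦ show x ∈ P by rw [h]; trivial⟩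
  have hmem : a • (Submodule.Quotient.mk 1 : B ⧸ m) ∈ P :=
    show _ ∈ N from Submodule.smul_mem_smul (mem_jacRad_iff.1 ha) trivial
  rw [hP, Submodule.mem_bot, smul_def, ← Submodule.Quotient.mk_smul,
    Submodule.Quotient.mk_eq_zero, smul_eq_mul, mul_one] at hmem
  exact hmem

/-- Restriction of scalars from `A ∗ G` to `A`. -/
noncomputable abbrev res : ModuleCat.{u} B ⥤ ModuleCat.{u} A :=
  ModuleCat.restrictScalars.{u} (H.ιA : A →+* B)

/-- Coinduction of modules from `A` to `A ∗ G`. -/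
noncomputable abbrev coind : ModuleCat.{u} A ⥤ ModuleCat.{u} B :=
  ModuleCat.coextendScalars (H.ιA : A →+* B)

/-- The value of an element of a coinduced module at an element of the skew group algebra. -/
noncomputable def ev {N : ModuleCat.{u} A} (f : H.coind.obj N) (b : B) : N := f b

lemma ev_add {N : ModuleCat.{u} A} (f f' : H.coind.obj N) (b : B) :
    H.ev (f + f') b = H.ev f b + H.ev f' b :=
  rfl

lemma ev_smul {N : ModuleCat.{u} A} (b : B) (f : H.coind.obj N) (b' : B) :
    H.ev (b • f) b' = H.ev f (b' * b) :=
  rfl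

lemma ev_map {N N' : ModuleCat.{u} A} (p : N ⟶ N') (f : H.coind.obj N) (b : B) :
    H.ev (H.coind.map p f) b = p (H.ev f b) :=
  rfl

lemma ev_sum {N : ModuleCat.{u} A} {ι : Type*} (s : Finset ι) (f : ι → H.coind.obj N) (b : B) :
    H.ev (∑ k ∈ s, f k) b = ∑ k ∈ s, H.ev (f k) b :=
  map_sum (AddMonoidHom.mk' (fun f ↦ H.ev f b) fun f f' ↦ H.ev_add f f' b) f s

lemma ev_ιA_mul {N : ModuleCat.{u} A} (f : H.coind.obj N) (a : A) (b : B) :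
    H.ev f (H.ιA a * b) = a • H.ev f b :=
  (ModuleCat.CoextendScalars.equiv (H.ιA : A →+* B) N f).map_smul a b

lemma ev_eq_sum {N : ModuleCat.{u} A} (f : H.coind.obj N) (b : B) :
    H.ev f b = ∑ g, H.coeff b g • H.ev f (H.ιG g) := by
  simp only [← H.ev_ιA_mul]
  conv_lhs => rw [← H.sum_coeff b]
  exact map_sum (ModuleCat.CoextendScalars.equiv (H.ιA : A →+* B) N f) _ _

lemma coind_ext {N : ModuleCat.{u} A} {f f' : H.coind.obj N}
    (h : ∀ g, H.ev f (H.ιG g) = H.ev f' (H.ιG g)) : f = f' := by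
  have hb (b : B) : H.ev f b = H.ev f' b := by
    rw [ev_eq_sum, H.ev_eq_sum f']
    simp [h]
  exact ModuleCat.CoextendScalars.ext (LinearMap.ext hb)

/-- The element of a coinduced module with given values on `G`. -/
noncomputable def coindMk {N : ModuleCat.{u} A} (c : G → N) : H.coind.obj N :=
  (ModuleCat.CoextendScalars.equiv (H.ιA : A →+* B) N).symm
    { toFun := fun b : B ↦ ∑ g, H.coeff b g • c g
      map_add' := fun b b' : B ↦ by
        change ∑ g, H.coeff (b + b') g • c g = ∑ g, H.coeff b g • c g + ∑ g, H.coeff b' g • c g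
        simp [coeff_add, add_smul, Finset.sum_add_distrib]
      map_smul' := fun a (b : B) ↦ by
        change ∑ g, H.coeff (H.ιA a * b) g • c g = a • ∑ g, H.coeff b g • c g
        simp [coeff_ιA_mul, Finset.smul_sum, mul_smul] }

lemma ev_coindMk {N : ModuleCat.{u} A} (c : G → N) (g : G) :
    H.ev (H.coindMk c) (H.ιG g) = c g := by
  classical
  change ∑ k, H.coeff (H.ιG g) k • c k = c g
  simp [coeff_ιG, Pi.single_apply, ite_smul]

instance : H.coind.Additive where

instance : Limits.PreservesFiniteColimits H.coind := by
  refine (Functor.preservesFiniteColimits_iff_forall_exact_map_and_epi _).2 fun S hS ↦ ⟨?_, ?_⟩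
  · exact hS.exact.map_of_mono_of_preservesKernel _ hS.mono_f inferInstance
  · have := hS.epi_g
    rw [ModuleCat.epi_iff_surjective]
    intro f
    choose c hc using fun g ↦ (ModuleCat.epi_iff_surjective S.g).1 hS.epi_g (H.ev f (H.ιG g))
    refine ⟨H.coindMk c, H.coind_ext fun g ↦ ?_⟩
    rw [ev_map, ev_coindMk, hc]

instance : Limits.PreservesFiniteLimits H.res := by
  refine (Functor.preservesFiniteLimits_iff_forall_exact_map_and_mono _).2 fun S hS ↦ ⟨?_, ?_⟩
  · exact hS.exact.map_of_epi_of_preservesCokernel _ hS.epi_g inferInstance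
  · have := hS.mono_f
    rw [ModuleCat.mono_iff_injective]
    exact (ModuleCat.mono_iff_injective S.f).1 hS.mono_f

include H in
lemma comm_inv (g : G) (a : A) : H.ιG g⁻¹ * H.ιA (φ g a) = H.ιA a * H.ιG g⁻¹ := by
  rw [H.comm, ← AlgEquiv.mul_apply, ← map_mul, inv_mul_cancel, map_one, AlgEquiv.one_apply]

/-- The map out of a coinduced module, viewed as an induced module, with components `j`. -/
noncomputable def coindDesc {N : ModuleCat.{u} A} {N' : ModuleCat.{u} B} (j : G → N →+ N')
    (h : ∀ a g k x, (H.ιA a * H.ιG g) • j (k * g) x = j k (φ k a • x)) :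
    H.coind.obj N ⟶ N' :=
  ModuleCat.ofHom
    (let t : H.coind.obj N →+ N' :=
      AddMonoidHom.mk' (fun f ↦ ∑ k, j k (H.ev f (H.ιG k))) fun f f' ↦ by
        simp [ev_add, Finset.sum_add_distrib]
    { t with
      map_smul' := H.map_smul_of_forall t fun a g f ↦ by
        change ∑ k, j k (H.ev ((H.ιA a * H.ιG g) • f) (H.ιG k)) =
          (H.ιA a * H.ιG g) • ∑ k, j k (H.ev f (H.ιG k))
        rw [Finset.smul_sum, ← Equiv.sum_comp (Equiv.mulRight g)
          fun k ↦ (H.ιA a * H.ιG g) • j k (H.ev f (H.ιG k))]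
        refine Finset.sum_congr rfl fun k _ ↦ ?_
        rw [Equiv.coe_mulRight, h, ev_smul, ← mul_assoc, H.comm, mul_assoc, ← map_mul,
          ev_ιA_mul] })

open Classical in
/-- The inclusion of an `A`-module into its coinduced module as the component at `1`. -/
noncomputable def toResCoind : 𝟭 (ModuleCat.{u} A) ⟶ H.coind ⋙ H.res where
  app N := ModuleCat.ofHom (X := N) (Y := H.res.obj (H.coind.obj N))
    { toFun := fun n ↦ H.coindMk (Pi.single 1 n)
      map_add' := fun n n' ↦ H.coind_ext fun g ↦ by
        refine Eq.trans ?_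
          (H.ev_add (H.coindMk (Pi.single 1 n)) (H.coindMk (Pi.single 1 n')) _).symm
        rw [ev_coindMk, ev_coindMk, ev_coindMk, Pi.single_add]
        rfl
      map_smul' := fun a n ↦ H.coind_ext fun g ↦ by
        change _ = H.ev (H.ιA a • H.coindMk (Pi.single 1 n)) (H.ιG g)
        rw [ev_smul, H.comm, ev_ιA_mul, ev_coindMk, ev_coindMk]
        by_cases hg : g = 1
        · subst hg
          simp
        · simp [hg] }
  naturality N N' f := by
    ext n
    refine H.coind_ext fun g ↦ ?_
    change H.ev (H.coindMk (Pi.single 1 (f n))) (H.ιG g) =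
      H.ev (H.coind.map f (H.coindMk (Pi.single 1 n))) (H.ιG g)
    rw [ev_map, ev_coindMk, ev_coindMk]
    by_cases hg : g = 1
    · subst hg
      simp
    · simp [hg]

/-- Evaluation at `1`. -/
noncomputable def ofResCoind : H.coind ⋙ H.res ⟶ 𝟭 (ModuleCat.{u} A) :=
  ModuleCat.RestrictionCoextensionAdj.counit' (H.ιA : A →+* B)

lemma toResCoind_comp_ofResCoind : H.toResCoind ≫ H.ofResCoind = 𝟙 _ := by
  classical
  ext N n
  change H.ev (H.coindMk (Pi.single 1 n)) 1 = n
  rw [← map_one H.ιG, ev_coindMk, Pi.single_eq_same]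

/-- The unit of the restriction-coinduction adjunction. -/
noncomputable def toCoindRes : 𝟭 (ModuleCat.{u} B) ⟶ H.res ⋙ H.coind :=
  ModuleCat.RestrictionCoextensionAdj.unit' (H.ιA : A →+* B)

/-- The averaging map. -/
noncomputable def ofCoindRes : H.res ⋙ H.coind ⟶ 𝟭 (ModuleCat.{u} B) where
  app N := H.coindDesc (N := H.res.obj N) (N' := N)
    (fun k ↦ DistribSMul.toAddMonoidHom N
      (algebraMap K B (Fintype.card G : K)⁻¹ * H.ιG k⁻¹)) fun a g k x ↦ by
    change (H.ιA a * H.ιG g) • (algebraMap K B (Fintype.card G : K)⁻¹ * H.ιG (k * g)⁻¹) • (x : N) =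
      (algebraMap K B (Fintype.card G : K)⁻¹ * H.ιG k⁻¹) • H.ιA (φ k a) • (x : N)
    rw [← mul_smul, ← mul_smul]
    congr 1
    rw [mul_assoc _ (H.ιG k⁻¹), H.comm_inv, ← mul_assoc _ (algebraMap K B _),
      ← Algebra.commutes, mul_assoc, mul_assoc, ← map_mul, mul_inv_rev, mul_inv_cancel_left]
  naturality N N' f := by
    ext x
    change ∑ k, (algebraMap K B (Fintype.card G : K)⁻¹ * H.ιG k⁻¹) •
        f (H.ev (N := H.res.obj N) x (H.ιG k)) =
      f (∑ k, (algebraMap K B (Fintype.card G : K)⁻¹ * H.ιG k⁻¹) •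
        (show N from H.ev (N := H.res.obj N) x (H.ιG k)))
    rw [map_sum]
    exact Finset.sum_congr rfl fun k _ ↦ (map_smul f.hom _ _).symm

lemma toCoindRes_comp_ofCoindRes (hchar : (Fintype.card G : K) ≠ 0) :
    H.toCoindRes ≫ H.ofCoindRes = 𝟙 _ := by
  ext N n
  change ∑ k, (algebraMap K B (Fintype.card G : K)⁻¹ * H.ιG k⁻¹) • H.ιG k • (n : N) = n
  simp only [← mul_smul, mul_assoc, ← map_mul, inv_mul_cancel, map_one, mul_one]
  rw [Finset.sum_const, Finset.card_univ, ← Nat.cast_smul_eq_nsmul B, ← mul_smul,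
    ← map_natCast (algebraMap K B), ← map_mul, mul_inv_cancel₀ hchar, map_one, one_smul]

lemma exists_comp_eq_id (hchar : (Fintype.card G : K) ≠ 0) {P X : ModuleCat.{u} B} (i : P ⟶ X)
    (r : H.res.obj X ⟶ H.res.obj P) (hr : H.res.map i ≫ r = 𝟙 _) :
    ∃ π : X ⟶ P, i ≫ π = 𝟙 P := by
  refine ⟨H.toCoindRes.app X ≫ H.coind.map r ≫ H.ofCoindRes.app P, ?_⟩
  have hn := H.toCoindRes.naturality i
  dsimp only [Functor.id_map, Functor.comp_map] at hn
  rw [reassoc_of% hn, ← Functor.map_comp_assoc, hr, CategoryTheory.Functor.map_id]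
  exact (congrArg _ (Category.id_comp _)).trans
    (congrArg (fun α ↦ α.app P) (H.toCoindRes_comp_ofCoindRes hchar))

include H in
/-- **Maschke's theorem** for skew group algebras. -/
lemma isSemisimpleModule (hchar : (Fintype.card G : K) ≠ 0) (X : ModuleCat.{u} B)
    [IsSemisimpleModule A (H.res.obj X)] : IsSemisimpleModule B X := by
  refine (isSemisimpleModule_iff B X).2 ⟨fun P ↦ ?_⟩
  let i : ModuleCat.of B P ⟶ X := ModuleCat.ofHom P.subtype
  obtain ⟨r, hr⟩ : ∃ r : H.res.obj X ⟶ H.res.obj (ModuleCat.of B P), H.res.map i ≫ r = 𝟙 _ := by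
    obtain ⟨r, hr⟩ := IsSemisimpleModule.extension_property (R := A)
      (N := H.res.obj (ModuleCat.of B P)) (M := H.res.obj X) (P := H.res.obj (ModuleCat.of B P))
      (H.res.map i).hom P.injective_subtype LinearMap.id
    exact ⟨ModuleCat.ofHom (X := H.res.obj X) (Y := H.res.obj (ModuleCat.of B P)) r,
      ModuleCat.hom_ext hr⟩
  obtain ⟨π, hπ⟩ := H.exists_comp_eq_id hchar i r hr
  exact ⟨_, LinearMap.isCompl_of_proj (f := π.hom) fun x ↦ ConcreteCategory.congr_hom hπ x⟩

lemma isSummandOfPower_res_ssQuot [FiniteDimensional K A] :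
    IsSummandOfPower (H.res.obj (ssQuot B)) (ssQuot A) := by
  have := IsArtinianRing.of_finite K A
  have hfin : Module.Finite A (H.res.obj (ssQuot B)) := by
    have := H.moduleFinite
    let _ : Module K (H.res.obj (ssQuot B)) := inferInstanceAs (Module K (B ⧸ jacRad B))
    have : IsScalarTower K A (H.res.obj (ssQuot B)) := ⟨fun k a x ↦ by
      change H.ιA (k • a) • (show B ⧸ jacRad B from x) =
        k • H.ιA a • (show B ⧸ jacRad B from x)
      rw [map_smul, smul_assoc]⟩
    have : Module.Finite K (H.res.obj (ssQuot B)) :=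
      inferInstanceAs (Module.Finite K (B ⧸ jacRad B))
    exact Module.Finite.of_restrictScalars_finite K A _
  exact isSummandOfPower_ssQuot _ fun a ha x ↦
    jacRad_smul_quotient_eq_zero (H.ιA_mem_jacRad ha) x

lemma moduleFinite_coind_ssQuot : Module.Finite B (H.coind.obj (ssQuot A)) := by
  classical
  let δ : H.coind.obj (ssQuot A) :=
    H.coindMk (Pi.single 1 (Submodule.Quotient.mk 1 : A ⧸ jacRad A))
  refine ⟨⟨{δ}, eq_top_iff.2 fun f _ ↦ ?_⟩⟩
  choose c hc using fun g ↦ Submodule.Quotient.mk_surjective (jacRad A) (H.ev f (H.ιG g))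
  have hf : f = ∑ k, (H.ιG k⁻¹ * H.ιA (c k)) • δ := by
    refine H.coind_ext fun g ↦ ?_
    rw [ev_sum, Finset.sum_eq_single g (fun k _ hk ↦ ?_) (by simp)]
    · rw [ev_smul, ← mul_assoc, ← map_mul, mul_inv_cancel, map_one, one_mul, ← mul_one (H.ιA _),
        ev_ιA_mul, ← map_one H.ιG, ev_coindMk, Pi.single_eq_same, ← hc]
      exact congrArg _ (mul_one (c g)).symm
    · rw [ev_smul, ← mul_assoc, ← map_mul, H.comm, ev_ιA_mul, ev_coindMk, Pi.single_eq_of_ne,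
        smul_zero]
      rwa [Ne, mul_inv_eq_one, eq_comm]
  rw [hf]
  refine Submodule.sum_mem _ fun k _ ↦ Submodule.smul_mem _ _ (Submodule.subset_span ?_)
  simp

lemma isSummandOfPower_coind_ssQuot [FiniteDimensional K A] (hchar : (Fintype.card G : K) ≠ 0) :
    IsSummandOfPower (H.coind.obj (ssQuot A)) (ssQuot B) := by
  have := IsArtinianRing.of_finite K A
  have := H.moduleFinite
  have := IsArtinianRing.of_finite K B
  have := H.moduleFinite_coind_ssQuot
  have : IsSemisimpleModule A (H.res.obj (H.coind.obj (ssQuot A))) :=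
    isSemisimpleModule_of_jacRad_smul_eq_zero fun a ha f ↦ H.coind_ext fun g ↦ by
      refine (H.ev_smul (H.ιA a) f (H.ιG g)).trans ?_
      rw [H.comm]
      refine (H.ev_ιA_mul f _ _).trans ?_
      exact jacRad_smul_quotient_eq_zero (map_mem_jacRad (φ g : A ≃+* A) ha) _
  have := H.isSemisimpleModule hchar (H.coind.obj (ssQuot A))
  exact isSummandOfPower_ssQuot _ fun b hb f ↦
    Module.mem_annihilator.1 (IsSemisimpleModule.jacobson_le_annihilator B _
      (mem_jacRad_iff.1 hb)) f

end IsSkewGroupAlgebra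

namespace IsSkewGroupAlgebra

variable {K : Type u} [Field K] {A : Type u} [Ring A] [Algebra K A]
  {G : Type u} [Group G] [Fintype G] {φ : G →* (A ≃ₐ[K] A)}
  {B : Type u} [Ring B] [Algebra K B] (H : IsSkewGroupAlgebra K A G φ B)
  {M : Type u} [AddCommGroup M] [Module B M]
  {T : Type u} [AddCommGroup T] [Module B T]

/-- The data exhibiting a module `T` over `A ∗ G` as the direct sum of copies of `M` indexed by
`G`, where `a g` maps the copy at `h` to the copy at `g h` through its action on `M`. -/
structure TwistedSum (M T : Type u) [AddCommGroup M] [Module B M] [AddCommGroup T]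
    [Module B T] where
  /-- The inclusion of the copy at `h`. -/
  incl : G → M →+ T
  /-- The projection onto the copy at `h`. -/
  proj : G → T →+ M
  sum_incl_proj (t : T) : ∑ h, incl h (proj h t) = t
  proj_incl (h : G) (m : M) : proj h (incl h m) = m
  proj_incl_of_ne {h h' : G} (hne : h ≠ h') (m : M) : proj h (incl h' m) = 0
  smul_incl (a : A) (g h : G) (m : M) :
    (H.ιA a * H.ιG g) • incl h m = incl (g * h) ((H.ιA a * H.ιG g) • m)

namespace TwistedSum

variable {H} (S : H.TwistedSum M T)

lemma ιA_smul_incl (a : A) (h : G) (m : M) : H.ιA a • S.incl h m = S.incl h (H.ιA a • m) := by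
  simpa using S.smul_incl a 1 h m

lemma ιG_smul_incl (g h : G) (m : M) : H.ιG g • S.incl h m = S.incl (g * h) (H.ιG g • m) := by
  simpa using S.smul_incl 1 g h m

lemma proj_ιA_smul (a : A) (h : G) (t : T) : S.proj h (H.ιA a • t) = H.ιA a • S.proj h t := by
  conv_lhs => rw [← S.sum_incl_proj t]
  rw [Finset.smul_sum, map_sum, Finset.sum_eq_single h (fun k _ hk ↦ ?_) (by simp), ιA_smul_incl,
    proj_incl]
  rw [ιA_smul_incl, S.proj_incl_of_ne hk.symm]

variable [Module A M] (hMA : ∀ (a : A) (m : M), H.ιA a • m = a • m)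

/-- The inclusions as morphisms of `A`-modules. -/
noncomputable def inclHom (h : G) : ModuleCat.of A M ⟶ H.res.obj (ModuleCat.of B T) :=
  ModuleCat.ofHom (X := M) (Y := H.res.obj (ModuleCat.of B T))
    { toFun := S.incl h
      map_add' := map_add (S.incl h)
      map_smul' := fun a m ↦ by
        rw [← hMA]
        exact (S.ιA_smul_incl a h m).symm }

/-- The projections as morphisms of `A`-modules. -/
noncomputable def projHom (h : G) : H.res.obj (ModuleCat.of B T) ⟶ ModuleCat.of A M :=
  ModuleCat.ofHom (X := H.res.obj (ModuleCat.of B T)) (Y := M)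
    { toFun := S.proj h
      map_add' := map_add (S.proj h)
      map_smul' := fun a t ↦ (S.proj_ιA_smul a h t).trans (hMA _ _) }

include S hMA in
lemma isSummandOfPower_res :
    IsSummandOfPower (H.res.obj (ModuleCat.of B T)) (ModuleCat.of A M) := by
  refine isSummandOfPower_of_fintype (S.projHom hMA) (S.inclHom hMA) ?_
  ext t
  rw [ModuleCat.hom_sum, LinearMap.sum_apply]
  exact S.sum_incl_proj t

include S hMA in
lemma isSummandOfPower_coind :
    IsSummandOfPower (H.coind.obj (ModuleCat.of A M)) (ModuleCat.of B T) := by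
  let p : H.coind.obj (ModuleCat.of A M) ⟶ ModuleCat.of B T :=
    H.coindDesc (N := ModuleCat.of A M) (N' := ModuleCat.of B T)
      (fun k ↦ (S.incl k⁻¹).comp (DistribSMul.toAddMonoidHom M (H.ιG k⁻¹))) fun a g k x ↦ by
      change (H.ιA a * H.ιG g) • S.incl (k * g)⁻¹ (H.ιG (k * g)⁻¹ • (x : M)) =
        S.incl k⁻¹ (H.ιG k⁻¹ • φ k a • (x : M))
      rw [← hMA, smul_incl, ← mul_smul, ← mul_smul, comm_inv, mul_assoc, ← map_mul, mul_inv_rev,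
        mul_inv_cancel_left]
  let i : ModuleCat.of B T ⟶ H.coind.obj (ModuleCat.of A M) :=
    H.toCoindRes.app (ModuleCat.of B T) ≫ H.coind.map (S.projHom hMA 1)
  refine isSummandOfPower_of_fintype (fun _ : Unit ↦ p) (fun _ ↦ i) ?_
  rw [Finset.univ_unique, Finset.sum_singleton]
  refine ModuleCat.hom_ext (LinearMap.ext fun f ↦ ?_)
  refine H.coind_ext fun g ↦ ?_
  change S.proj 1 (H.ιG g • ∑ k, S.incl k⁻¹ (H.ιG k⁻¹ • (H.ev f (H.ιG k) : M))) =
    H.ev f (H.ιG g)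
  rw [Finset.smul_sum, map_sum, Finset.sum_eq_single g (fun k _ hk ↦ ?_) (by simp), ιG_smul_incl,
    mul_inv_cancel, proj_incl, ← mul_smul, ← map_mul, mul_inv_cancel, map_one, one_smul]
  rw [ιG_smul_incl, S.proj_incl_of_ne]
  rwa [Ne, eq_comm, mul_inv_eq_one, eq_comm]

include S hMA in
theorem isQuasiKoszulModule_iff [FiniteDimensional K A] (hchar : (Fintype.card G : K) ≠ 0) :
    IsQuasiKoszulModule B (ModuleCat.of B T) ↔ IsQuasiKoszulModule A (ModuleCat.of A M) :=
  ⟨fun h i ↦ extSpan_eq_top_of_retract H.coind H.res H.toResCoind H.ofResCoind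
    H.toResCoind_comp_ofResCoind (S.isSummandOfPower_coind hMA)
    (H.isSummandOfPower_coind_ssQuot hchar) H.isSummandOfPower_res_ssQuot i 1 (h i),
  fun h i ↦ extSpan_eq_top_of_retract H.res H.coind H.toCoindRes H.ofCoindRes
    (H.toCoindRes_comp_ofCoindRes hchar) (S.isSummandOfPower_res hMA)
    H.isSummandOfPower_res_ssQuot (H.isSummandOfPower_coind_ssQuot hchar) i 1 (h i)⟩

end TwistedSum

open scoped TensorProduct in
/-- The module `M ⊗ KG` is a twisted sum of copies of `M`. -/
noncomputable def twistedSumTensor [Module K M] [Module B (M ⊗[K] MonoidAlgebra K G)]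
    (hMKG : ∀ (a : A) (g : G) (m : M) (h : G),
      (H.ιA a * H.ιG g) • (m ⊗ₜ[K] MonoidAlgebra.of K G h) =
        ((H.ιA a * H.ιG g) • m) ⊗ₜ[K] MonoidAlgebra.of K G (g * h)) :
    H.TwistedSum M (M ⊗[K] MonoidAlgebra K G) where
  incl h := ((TensorProduct.mk K M _).flip (MonoidAlgebra.of K G h)).toAddMonoidHom
  proj h := (TensorProduct.rid K M ∘ₗ LinearMap.lTensor M
    { toFun := fun x : MonoidAlgebra K G ↦ x.coeff h
      map_add' := fun _ _ ↦ rfl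
      map_smul' := fun _ _ ↦ rfl }).toAddMonoidHom
  sum_incl_proj t := by
    induction t with
    | zero => simp
    | add x y hx hy =>
      simp only [map_add, Finset.sum_add_distrib]
      rw [hx, hy]
    | tmul m x =>
      change ∑ h, (x.coeff h • m) ⊗ₜ[K] MonoidAlgebra.of K G h = m ⊗ₜ x
      simp only [TensorProduct.smul_tmul, ← TensorProduct.tmul_sum]
      congr 1
      ext g
      simp
  proj_incl h m := by
    change (MonoidAlgebra.of K G h).coeff h • m = m
    simp
  proj_incl_of_ne {h h'} hne m := by
    change (MonoidAlgebra.of K G h').coeff h • m = 0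
    simp [hne.symm]
  smul_incl a g h m := hMKG a g m h

end IsSkewGroupAlgebra

/- STATEMENT 13: For a finite-dimensional K-algebra A with an action of a finite group G
such that char K ∤ |G|, and a finitely generated A ∗ G-module M, the A ∗ G-module
M ⊗_K KG (with the twisted action (ag)(m ⊗ h) = a(gm) ⊗ gh) is quasi-Koszul iff M is a
quasi-Koszul A-module. -/

open TensorProduct

theorem stmt13 (K : Type u) [Field K] (A : Type u) [Ring A] [Algebra K A]
    [FiniteDimensional K A]
    (G : Type u) [Group G] [Fintype G] (φ : G →* (A ≃ₐ[K] A))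
    (B : Type u) [Ring B] [Algebra K B]
    (H : IsSkewGroupAlgebra K A G φ B)
    (hchar : (Fintype.card G : K) ≠ 0)
    -- M : a finitely generated A ∗ G-module
    (M : Type u) [AddCommGroup M] [Module B M] [Module A M] [Module K M]
    [Module.Finite B M]
    (hMA : ∀ (a : A) (m : M), H.ιA a • m = a • m)
    -- the twisted A ∗ G-module structure on M ⊗_K KG
    [Module B (M ⊗[K] MonoidAlgebra K G)]
    (hMKG : ∀ (a : A) (g : G) (m : M) (h : G),
      (H.ιA a * H.ιG g) • (m ⊗ₜ[K] MonoidAlgebra.of K G h) =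
        ((H.ιA a * H.ιG g) • m) ⊗ₜ[K] MonoidAlgebra.of K G (g * h)) :
    IsQuasiKoszulModule B (ModuleCat.of B (M ⊗[K] MonoidAlgebra K G)) ↔
      IsQuasiKoszulModule A (ModuleCat.of A M) := by
  exact (H.twistedSumTensor hMKG).isQuasiKoszulModule_iff hMA hchar
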